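/- arXiv:2002.00648 — 3 statements merged into one kernel-verified Lean document; each statement's English description precedes it below -/
import Mathlib

section
/- Let q be an odd prime power, let SU(4, q) be the subgroup of SL(4, F_{q²}) consisting of all matrices g with σ(g)ᵀ g = 1, where σ is the q-th power Frobenius applied entrywise, and let r be an odd prime dividing q² + 1. Then there exists g ∈ SU(4, q) of order r such that ⟨g⟩ ∩ Z(SU(4, q)) = 1. Such a g may be chosen so that its characteristic polynomial, regarded over F_{q⁴}, equals (X − θ)(X − θ^{−q})(X − θ^{q²})(X − θ^{−q³}) for some θ ∈ F_{q⁴} of multiplicative order r. -/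
open Matrix Polynomial

/-- The 2-part of a natural number: the highest power of `2` dividing it. -/
def twoPart (n : ℕ) : ℕ := 2 ^ padicValNat 2 n

/-- The special unitary group `SU(4, q)` inside `SL(4, F_{q²})`:
matrices `g` with `σ(g)ᵀ * g = 1`, where `σ` is the `q`-th power Frobenius. -/
def SU4 (p m : ℕ) [Fact p.Prime] (F : Type*) [Field F] [Fintype F] [CharP F p]
    (hF : Fintype.card F = (p ^ m) ^ 2) :
    Subgroup (SpecialLinearGroup (Fin 4) F) where
  carrier := { g | ((g : Matrix (Fin 4) (Fin 4) F).map (iterateFrobenius F p m))ᵀ * g = 1 }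
  one_mem' := by
    simp [Matrix.map_one]
  mul_mem' := by
    intro a b ha hb
    simp only [Set.mem_setOf_eq] at *
    have : ((a * b : SpecialLinearGroup (Fin 4) F) : Matrix (Fin 4) (Fin 4) F)
        = (a : Matrix (Fin 4) (Fin 4) F) * b := rfl
    rw [this, Matrix.map_mul, transpose_mul, mul_assoc,
      ← mul_assoc ((a : Matrix (Fin 4) (Fin 4) F).map _)ᵀ, ha, one_mul, hb]
  inv_mem' := by
    intro a ha
    simp only [Set.mem_setOf_eq] at *
    set σ := iterateFrobenius F p m with hσ
    set A := (a : Matrix (Fin 4) (Fin 4) F) with hA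
    have hdet : det ((A.map σ)ᵀ) = 1 := by
      rw [det_transpose, ← RingHom.mapMatrix_apply, ← RingHom.map_det, hA, a.det_coe,
        _root_.map_one]
    let M : SpecialLinearGroup (Fin 4) F := ⟨(A.map σ)ᵀ, hdet⟩
    have h1 : M * a = 1 := Subtype.ext ha
    have h2 : ((a⁻¹ : SpecialLinearGroup (Fin 4) F) : Matrix (Fin 4) (Fin 4) F)
        = (A.map σ)ᵀ := by
      rw [← eq_inv_of_mul_eq_one_left h1]
    rw [h2]
    have hσσ : ∀ x : F, σ (σ x) = x := by
      intro x
      rw [hσ, iterateFrobenius_def, iterateFrobenius_def, ← pow_mul, ← pow_two,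
        ← hF, FiniteField.pow_card]
    have h3 : ((A.map σ)ᵀ.map σ)ᵀ = A := by
      rw [← Matrix.transpose_map, transpose_transpose, Matrix.map_map]
      have : (⇑σ ∘ ⇑σ) = id := funext fun x => hσσ x
      rw [this, Matrix.map_id]
    rw [h3]
    exact mul_eq_one_comm.mp ha


/-- For `c * d = -1`, a matrix with characteristic polynomial
`(X² - 2aX + 1)(X² - 2bX + 1)`, which is unitary for an involution swapping `a`, `b`
and `c`, `d`. -/
def suMatrix {R : Type*} [CommRing R] (a b c d : R) : Matrix (Fin 4) (Fin 4) R :=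
  !![b, -1, d * b, 0; 1, a, 0, -(d * a); -(c * b), 0, b, -1; 0, c * a, 1, a]

theorem suMatrix_map {R S : Type*} [CommRing R] [CommRing S] (f : R →+* S) (a b c d : R) :
    (suMatrix a b c d).map f = suMatrix (f a) (f b) (f c) (f d) := by
  ext i j
  fin_cases i <;> fin_cases j <;> simp [suMatrix]

theorem suMatrix_transpose_mul {R : Type*} [CommRing R] {a b c d : R} (h : c * d = -1) :
    (suMatrix b a d c)ᵀ * suMatrix a b c d = 1 := by
  ext i j
  fin_cases i <;> fin_cases j <;>
    simp [suMatrix, Matrix.mul_apply, Fin.sum_univ_four] <;> grind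

theorem suMatrix_charpoly {R : Type*} [CommRing R] {a b c d : R} (h : c * d = -1) :
    (suMatrix a b c d).charpoly =
      (X ^ 2 - 2 * C a * X + 1) * (X ^ 2 - 2 * C b * X + 1) := by
  have h' : (C c : R[X]) * C d = -1 := by rw [← C_mul, h]; simp
  rw [Matrix.charpoly, Matrix.det_succ_row_zero]
  simp [suMatrix, Fin.sum_univ_succ, Matrix.det_fin_three, Matrix.charmatrix_apply,
    Fin.succAbove]
  grind

theorem suMatrix_det {R : Type*} [CommRing R] {a b c d : R} (h : c * d = -1) :
    (suMatrix a b c d).det = 1 := by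
  rw [Matrix.det_eq_sign_charpoly_coeff, suMatrix_charpoly h]
  norm_num [mul_coeff_zero]

/-- A finite subfield with `n` elements contains every solution of `x ^ n = x`. -/
theorem FiniteField.exists_map_eq_of_pow_card_eq {F E : Type*} [Field F] [Fintype F] [Field E]
    (f : F →+* E) {x : E} (hx : x ^ Fintype.card F = x) : ∃ y, f y = x := by
  classical
  have hne := FiniteField.X_pow_card_sub_X_ne_zero E (Fintype.one_lt_card (α := F))
  have hsub : Finset.univ.image f ⊆ (X ^ Fintype.card F - X : E[X]).roots.toFinset := by
    intro z hz
    obtain ⟨y, -, rfl⟩ := Finset.mem_image.mp hz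
    simp [hne, ← map_pow, FiniteField.pow_card]
  have heq := Finset.eq_of_subset_of_card_le hsub <| by
    rw [Finset.card_image_of_injective _ f.injective, Finset.card_univ]
    refine (Multiset.toFinset_card_le _).trans ((card_roots' _).trans ?_)
    rw [FiniteField.X_pow_card_sub_X_natDegree_eq E (Fintype.one_lt_card (α := F))]
  have hxmem : x ∈ Finset.univ.image f := by
    rw [heq]
    simp [hne, hx]
  simpa using hxmem

/-- `-1` is a norm from the field with `q²` elements to the one with `q` elements. -/
theorem FiniteField.exists_mul_pow_eq_neg_one {F : Type*} [Field F] [Fintype F] {q : ℕ}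
    (hq : Odd q) (hF : Fintype.card F = q ^ 2) : ∃ c : F, c * c ^ q = -1 := by
  obtain ⟨z, hz⟩ := IsCyclic.exists_generator (α := Fˣ)
  obtain ⟨k, rfl⟩ := hq
  have hcard : orderOf z = 4 * k * (k + 1) := by
    rw [orderOf_eq_card_of_forall_mem_zpowers hz, Nat.card_units, Nat.card_eq_fintype_card, hF]
    have : (2 * k + 1) ^ 2 = 4 * k * (k + 1) + 1 := by ring
    omega
  have hpos : 0 < orderOf z := orderOf_pos z
  have hne : z ^ (2 * k * (k + 1)) ≠ 1 := fun h => by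
    have := Nat.le_of_dvd (by nlinarith) (orderOf_dvd_of_pow_eq_one h)
    nlinarith
  have hsq : (z ^ (2 * k * (k + 1))) ^ 2 = 1 := by
    rw [← pow_mul, ← pow_orderOf_eq_one z, hcard]
    congr 1
    ring
  refine ⟨(z : F) ^ k, ?_⟩
  have hne' : ((z : F) ^ (2 * k * (k + 1))) ≠ 1 := fun h => hne (Units.ext (by simpa using h))
  have hsq' : ((z : F) ^ (2 * k * (k + 1))) ^ 2 = 1 := by
    simpa using congrArg Units.val hsq
  rw [← (sq_eq_one_iff.mp hsq').resolve_left hne']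
  ring

/-- A matrix whose characteristic polynomial splits with distinct roots that are `r`-th roots of
unity satisfies `M ^ r = 1`. -/
theorem Matrix.pow_eq_one_of_charpoly_eq_prod {K n ι : Type*} [Field K] [Fintype n]
    [DecidableEq n] [Fintype ι] {M : Matrix n n K} {r : ℕ} {x : ι → K}
    (hx : Function.Injective x) (hM : M.charpoly = ∏ i, (X - C (x i)))
    (hr : ∀ i, x i ^ r = 1) : M ^ r = 1 := by
  have hdvd : M.charpoly ∣ X ^ r - 1 := by
    rw [hM]
    refine Fintype.prod_dvd_of_coprime (pairwise_coprime_X_sub_C hx) fun i => ?_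
    rw [dvd_iff_isRoot]
    simp [hr]
  obtain ⟨s, hs⟩ := hdvd
  have h := congrArg (aeval M) hs
  rw [map_mul, Matrix.aeval_self_charpoly, zero_mul] at h
  simpa [sub_eq_zero] using h

theorem Subgroup.zpowers_inf_eq_bot_of_prime_orderOf {G : Type*} [Group G] {g : G} {H : Subgroup G}
    (hg : (orderOf g).Prime) (hgH : g ∉ H) : Subgroup.zpowers g ⊓ H = ⊥ := by
  have : Fact (Nat.card (Subgroup.zpowers g)).Prime := ⟨by rwa [Nat.card_zpowers]⟩
  rcases (H.subgroupOf (Subgroup.zpowers g)).eq_bot_or_eq_top_of_prime_card with h | h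
  · rw [inf_comm]
    exact (Subgroup.subgroupOf_eq_bot.mp h).eq_bot
  · exact absurd (Subgroup.subgroupOf_eq_top.mp h (Subgroup.mem_zpowers g)) hgH

theorem inv_ne_self_of_orderOf_odd_prime {G : Type*} [Group G] {t : G}
    (ht : (orderOf t).Prime) (hodd : Odd (orderOf t)) : t⁻¹ ≠ t := fun h => by
  have h2 : t ^ 2 = 1 := by rw [sq]; nth_rw 1 [← h]; simp
  have h3 := (Nat.prime_dvd_prime_iff_eq ht Nat.prime_two).mp (orderOf_dvd_of_pow_eq_one h2)
  rw [h3] at hodd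
  exact absurd hodd (by decide)

theorem injective_of_pow_sq_eq_inv {G : Type*} [Group G] {t : G} {q : ℕ} (hinv : t⁻¹ ≠ t)
    (hq : t ^ q ^ 2 = t⁻¹) :
    Function.Injective ![t, (t ^ q)⁻¹, t⁻¹, t ^ q] := by
  have hqq : (t ^ q) ^ q = t⁻¹ := by rw [← pow_mul, ← sq, hq]
  have h1 : t ^ q ≠ t := fun h => hinv (by rw [← hqq, h, h])
  have h2 : t ^ q ≠ t⁻¹ := fun h => hinv (by
    have := hqq
    rw [h, inv_pow, h, inv_inv] at this
    exact this.symm)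
  have h3 : (t ^ q)⁻¹ ≠ t ^ q := fun h => hinv (by
    have := congrArg (· ^ q) h
    simp only [inv_pow, hqq, inv_inv] at this
    exact this.symm)
  have h4 : (t ^ q)⁻¹ ≠ t := fun h => h2 (by rw [← inv_inv (t ^ q), h])
  have h5 : (t ^ q)⁻¹ ≠ t⁻¹ := fun h => h1 (inv_injective h)
  intro i j
  fin_cases i <;> fin_cases j <;>
    simp [hinv, hinv.symm, h1, h1.symm, h2, h2.symm, h3, h3.symm, h4, h4.symm, h5,
      h5.symm]

theorem mem_SU4_iff {p m : ℕ} [Fact p.Prime] {F : Type*} [Field F] [Fintype F] [CharP F p]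
    {hF : Fintype.card F = (p ^ m) ^ 2} {g : SpecialLinearGroup (Fin 4) F} :
    g ∈ SU4 p m F hF ↔
      ((g : Matrix (Fin 4) (Fin 4) F).map (iterateFrobenius F p m))ᵀ * g = 1 :=
  Iff.rfl

theorem not_mem_center_SU4_of_apply_zero_one_ne_zero {p m : ℕ} [Fact p.Prime] {F : Type*}
    [Field F] [Fintype F] [CharP F p] {hF : Fintype.card F = (p ^ m) ^ 2} (h2 : (2 : F) ≠ 0)
    (g : SU4 p m F hF)
    (hg : ((g : SpecialLinearGroup (Fin 4) F) : Matrix (Fin 4) (Fin 4) F) 0 1 ≠ 0) :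
    g ∉ Subgroup.center (SU4 p m F hF) := by
  intro hc
  let D : SpecialLinearGroup (Fin 4) F :=
    ⟨diagonal ![-1, 1, -1, 1], by simp [det_diagonal, Fin.prod_univ_four]⟩
  have hD : D ∈ SU4 p m F hF := by
    rw [mem_SU4_iff]
    ext i j
    fin_cases i <;> fin_cases j <;>
      simp [D, Matrix.mul_apply, diagonal]
  have h := Subgroup.mem_center_iff.mp hc ⟨D, hD⟩
  have h' : (diagonal (![-1, 1, -1, 1] : Fin 4 → F) * g.1.1 : Matrix (Fin 4) (Fin 4) F) 0 1 =
      (g.1.1 * diagonal (![-1, 1, -1, 1] : Fin 4 → F) : Matrix (Fin 4) (Fin 4) F) 0 1 :=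
    congrArg (fun x : SU4 p m F hF => x.1.1 0 1) h
  rw [diagonal_mul, mul_diagonal] at h'
  simp only [Matrix.cons_val] at h'
  grind

/-- For `q` an odd prime power and `r` an odd prime dividing `q² + 1`, there is
`g ∈ SU(4, q)` of order `r` intersecting the center trivially; moreover `g` may be chosen
with characteristic polynomial `(X - θ)(X - θ^{-q})(X - θ^{q²})(X - θ^{-q³})` over
`F_{q⁴}`, where `θ` has multiplicative order `r`. -/
theorem su4_element_order_r4
    (p m q : ℕ) [Fact p.Prime] (hq : q = p ^ m) (hodd : Odd q)
    (F : Type) [Field F] [Fintype F] [CharP F p] (hF : Fintype.card F = (p ^ m) ^ 2)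
    (E : Type) [Field E] [Fintype E] (hE : Fintype.card E = q ^ 4)
    (f : F →+* E)
    (r : ℕ) (hr : r.Prime) (hrodd : Odd r) (hrdvd : r ∣ q ^ 2 + 1) :
    ∃ g : (SU4 p m F hF), orderOf g = r ∧
      Subgroup.zpowers g ⊓ Subgroup.center (SU4 p m F hF) = ⊥ ∧
      ∃ θ : Eˣ, orderOf θ = r ∧
        Matrix.charpoly
            (((g : SpecialLinearGroup (Fin 4) F) : Matrix (Fin 4) (Fin 4) F).map f) =
          (X - C ((θ : E))) * (X - C ((θ ^ (-(q : ℤ)) : Eˣ) : E)) *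
            (X - C ((θ ^ ((q : ℤ) ^ 2) : Eˣ) : E)) *
            (X - C ((θ ^ (-((q : ℤ) ^ 3)) : Eˣ) : E)) := by
  subst hq
  set q := p ^ m with hq
  have hE4 : Nat.card Eˣ = (q ^ 2 + 1) * (q ^ 2 - 1) := by
    rw [Nat.card_units, Nat.card_eq_fintype_card, hE, ← Nat.sq_sub_sq]
    ring_nf
  have : Fact r.Prime := ⟨hr⟩
  obtain ⟨θ, hθ⟩ := exists_prime_orderOf_dvd_card' (G := Eˣ) r
    (hE4 ▸ hrdvd.mul_right _)
  have hθ1 : θ ^ (q ^ 2 + 1) = 1 := orderOf_dvd_iff_pow_eq_one.mp (hθ ▸ hrdvd)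
  have hθq : θ ^ q ^ 2 = θ⁻¹ := eq_inv_of_mul_eq_one_left (by rw [← pow_succ, hθ1])
  have hinj := injective_of_pow_sq_eq_inv
    (inv_ne_self_of_orderOf_odd_prime (hθ ▸ hr) (hθ ▸ hrodd)) hθq
  have : CharP E p := charP_of_injective_ringHom f.injective p
  have hp2 : p ≠ 2 := by
    rintro rfl
    have hm : m ≠ 0 := by
      rintro rfl
      have := Fintype.one_lt_card (α := F)
      simp [hF, hq] at this
    exact absurd hodd (by simp [hq, Nat.odd_pow_iff hm])
  have h2 : (2 : F) ≠ 0 := Ring.two_ne_zero (by rwa [ringChar.eq F p])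
  have hσ (x : F) : iterateFrobenius F p m x = x ^ q := iterateFrobenius_def p m x
  have hσσ (x : F) : (x ^ q) ^ q = x := by
    rw [← pow_mul, ← sq, ← hF, FiniteField.pow_card]
  obtain ⟨c, hc⟩ := FiniteField.exists_mul_pow_eq_neg_one hodd hF
  obtain ⟨s, hs⟩ : ∃ s, f s = θ + (θ⁻¹ : Eˣ) := by
    refine FiniteField.exists_map_eq_of_pow_card_eq f ?_
    rw [hF, hq, ← pow_mul, add_pow_char_pow, pow_mul, ← hq, ← Units.val_pow_eq_pow_val,
      ← Units.val_pow_eq_pow_val, inv_pow, hθq, inv_inv, add_comm]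
  have hs' : f s ^ q = (θ ^ q : Eˣ) + ((θ ^ q)⁻¹ : Eˣ) := by
    rw [hs, hq, add_pow_char_pow, ← inv_pow]
    simp
  have h2q : (2 : F) ^ q = 2 := by rw [← hσ, map_ofNat]
  have h2E : (2 : E) ≠ 0 := by simpa only [map_ofNat, map_zero] using f.injective.ne h2
  let M := suMatrix (s / 2) ((s / 2) ^ q) c (c ^ q)
  let gS : SpecialLinearGroup (Fin 4) F := ⟨M, suMatrix_det hc⟩
  have hgS : gS ∈ SU4 p m F hF := by
    rw [mem_SU4_iff]
    change (M.map _)ᵀ * M = 1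
    rw [suMatrix_map]
    simp only [hσ, hσσ]
    exact suMatrix_transpose_mul hc
  have hchar : (M.map f).charpoly =
      ∏ i, (X - C (((![θ, (θ ^ q)⁻¹, θ⁻¹, θ ^ q] i : Eˣ)) : E)) := by
    rw [suMatrix_map, suMatrix_charpoly (by rw [← map_mul, hc]; simp)]
    have e1 : 2 * C (f (s / 2)) = C (θ : E) + C ((θ⁻¹ : Eˣ) : E) := by
      rw [← C_add, ← hs, ← C_ofNat, ← C_mul, map_div₀, map_ofNat, mul_div_cancel₀ _ h2E]
    have e2 : 2 * C (f ((s / 2) ^ q)) = C ((θ ^ q : Eˣ) : E) + C (((θ ^ q)⁻¹ : Eˣ) : E) := by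
      rw [← C_add, ← hs', ← C_ofNat, ← C_mul, div_pow, h2q, map_div₀, map_ofNat,
        mul_div_cancel₀ _ h2E, map_pow]
    have e3 (t : Eˣ) : C (t : E) * C ((t⁻¹ : Eˣ) : E) = 1 := by
      rw [← C_mul, Units.mul_inv, C_1]
    rw [e1, e2, Fin.prod_univ_four]
    simp only [Matrix.cons_val]
    linear_combination (-(X ^ 2 - (C ((θ ^ q : Eˣ) : E) + C (((θ ^ q)⁻¹ : Eˣ) : E)) * X + 1)) *
        e3 θ - ((X - C (θ : E)) * (X - C ((θ⁻¹ : Eˣ) : E))) * e3 (θ ^ q)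
  have hpow : M ^ r = 1 := by
    have hr1 : θ ^ r = 1 := hθ ▸ pow_orderOf_eq_one θ
    have hq1 : (θ ^ q) ^ r = 1 := by rw [← pow_mul, mul_comm, pow_mul, hr1, one_pow]
    have h : (M.map f) ^ r = 1 := by
      refine Matrix.pow_eq_one_of_charpoly_eq_prod (Units.val_injective.comp hinj) hchar fun i => ?_
      rw [Function.comp_apply, ← Units.val_pow_eq_pow_val, Units.val_eq_one]
      fin_cases i <;> simp [hr1, hq1]
    apply Matrix.map_injective f.injective
    change f.mapMatrix (M ^ r) = f.mapMatrix 1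
    rw [map_pow, map_one]
    exact h
  let g : SU4 p m F hF := ⟨gS, hgS⟩
  have hg01 : ((g : SpecialLinearGroup (Fin 4) F) : Matrix (Fin 4) (Fin 4) F) 0 1 ≠ 0 := by
    simp [g, gS, M, suMatrix]
  have hgr : g ^ r = 1 :=
    Subtype.ext (Subtype.ext ((Matrix.SpecialLinearGroup.coe_pow gS r).trans hpow))
  have hg : orderOf g = r := orderOf_eq_prime hgr (by
    intro h
    rw [h] at hg01
    simp at hg01)
  refine ⟨g, hg, Subgroup.zpowers_inf_eq_bot_of_prime_orderOf (hg ▸ hr)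
    (not_mem_center_SU4_of_apply_zero_one_ne_zero h2 g hg01), θ, hθ, ?_⟩
  have z1 : θ ^ (-(q : ℤ)) = (θ ^ q)⁻¹ := by rw [_root_.zpow_neg, zpow_natCast]
  have z2 : θ ^ ((q : ℤ) ^ 2) = θ⁻¹ := by rw [← Nat.cast_pow, zpow_natCast, hθq]
  have z3 : θ ^ (-((q : ℤ) ^ 3)) = θ ^ q := by
    rw [_root_.zpow_neg, ← Nat.cast_pow, zpow_natCast, pow_succ, pow_mul, hθq, inv_pow, inv_inv]
  rw [z1, z2, z3]
  change (M.map f).charpoly = _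
  rw [hchar, Fin.prod_univ_four]
  simp only [Matrix.cons_val]
end

section
/- Let q be a prime power with q ≡ 1 (mod 4), let SU(4, q) be the subgroup of SL(4, F_{q²}) consisting of all matrices g with σ(g)ᵀ g = 1, where σ is the q-th power Frobenius applied entrywise, and set t = (q² − 1)₂, the 2-part of q² − 1. Then there exists g ∈ SU(4, q) of order t such that ⟨g⟩ ∩ Z(SU(4, q)) = 1. -/
open Matrix Polynomial

/-- The matrix with eigenvalues `x, y` on the plane spanned by the first two coordinates
(with eigenvectors `(1, -i)` and `(1, i)`) and `z, 1` on the last two coordinates. -/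
def planeRotation {F : Type*} [Field F] (i x y z : F) : Matrix (Fin 4) (Fin 4) F :=
  !![(x + y) / 2, i * (x - y) / 2, 0, 0;
     -(i * (x - y) / 2), (x + y) / 2, 0, 0;
     0, 0, z, 0;
     0, 0, 0, 1]

/-- A signed cyclic permutation matrix. -/
def signedCycle (F : Type*) [Field F] : Matrix (Fin 4) (Fin 4) F :=
  !![0, 0, 0, -1;
     1, 0, 0, 0;
     0, 1, 0, 0;
     0, 0, 1, 0]

section Matrices

variable {F : Type*} [Field F]

theorem planeRotation_mul {i : F} (h2 : (2 : F) ≠ 0) (hi : i ^ 2 = -1) (x y z x' y' z' : F) :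
    planeRotation i x y z * planeRotation i x' y' z' =
      planeRotation i (x * x') (y * y') (z * z') := by
  ext a b
  fin_cases a <;> fin_cases b <;>
    simp [planeRotation, Matrix.mul_apply, Fin.sum_univ_four] <;> field_simp <;> grind

theorem planeRotation_one {i : F} (h2 : (2 : F) ≠ 0) : planeRotation i 1 1 1 = 1 := by
  ext a b
  fin_cases a <;> fin_cases b <;> simp [planeRotation] <;> field_simp <;> norm_num

theorem planeRotation_pow {i : F} (h2 : (2 : F) ≠ 0) (hi : i ^ 2 = -1) (x y z : F) (n : ℕ) :
    planeRotation i x y z ^ n = planeRotation i (x ^ n) (y ^ n) (z ^ n) := by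
  induction n with
  | zero => simp [planeRotation_one h2]
  | succ n ih => rw [pow_succ, ih, planeRotation_mul h2 hi, pow_succ, pow_succ, pow_succ]

theorem det_planeRotation {i : F} (h2 : (2 : F) ≠ 0) (hi : i ^ 2 = -1) (x y z : F) :
    (planeRotation i x y z).det = x * y * z := by
  simp [planeRotation, Matrix.det_succ_row_zero, Fin.sum_univ_succ, Fin.succAbove]
  field_simp
  grind

theorem planeRotation_map_transpose {i : F} {σ : F →+* F} (hi : σ i = i) (x y z : F) :
    ((planeRotation i x y z).map σ)ᵀ = planeRotation i (σ y) (σ x) (σ z) := by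
  ext a b
  fin_cases a <;> fin_cases b <;> simp [planeRotation, hi, map_ofNat] <;> ring

theorem eq_one_of_planeRotation_eq_one {i x y z : F} (h2 : (2 : F) ≠ 0) (hi : i ^ 2 = -1)
    (h : planeRotation i x y z = 1) : x = 1 := by
  have h00 := congrFun (congrFun h 0) 0
  have h01 := congrFun (congrFun h 0) 1
  simp [planeRotation] at h00 h01
  have hi0 : i ≠ 0 := by rintro rfl; simp at hi
  field_simp at h00
  have hxy : x - y = 0 := by simpa [hi0, h2] using h01
  exact mul_left_cancel₀ h2 (by linear_combination h00 + hxy)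

theorem det_signedCycle : (signedCycle F).det = 1 := by
  simp [signedCycle, Matrix.det_succ_row_zero, Fin.sum_univ_succ, Fin.succAbove,
    Odd.neg_one_pow (show Odd 3 by decide)]

theorem signedCycle_map_transpose_mul (σ : F →+* F) :
    ((signedCycle F).map σ)ᵀ * signedCycle F = 1 := by
  ext a b
  fin_cases a <;> fin_cases b <;> simp [signedCycle, Matrix.mul_apply, Fin.sum_univ_four]

/-- A matrix commuting with the signed cycle and fixing the last basis vector is trivial. -/
theorem planeRotation_eq_one_of_commute {i x y z : F}
    (h : Commute (planeRotation i x y z) (signedCycle F)) : planeRotation i x y z = 1 := by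
  have H := fun a b => congrFun (congrFun h.eq a) b
  have h03 := H 0 3
  have h13 := H 1 3
  have h21 := H 2 1
  have h32 := H 3 2
  have h10 := H 1 0
  simp [planeRotation, signedCycle, Matrix.mul_apply, Fin.sum_univ_four] at h03 h13 h21 h32 h10
  ext a b
  fin_cases a <;> fin_cases b <;> simp [planeRotation] <;> grind

end Matrices

theorem twoPart_dvd {n : ℕ} : twoPart n ∣ n := pow_padicValNat_dvd

theorem twoPart_sq_sub_one {q : ℕ} (h1 : 1 < q) (hq4 : q % 4 = 1) :
    twoPart (q ^ 2 - 1) = 2 * twoPart (q - 1) := by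
  have hfac : q ^ 2 - 1 = (q - 1) * (2 * ((q + 1) / 2)) := by
    rw [Nat.mul_div_cancel' (by omega), mul_comm]
    simpa using Nat.sq_sub_sq q 1
  have hodd : padicValNat 2 ((q + 1) / 2) = 0 := padicValNat.eq_zero_of_not_dvd (by omega)
  rw [twoPart, twoPart, hfac, padicValNat.mul (by omega) (by omega),
    padicValNat.mul (by omega) (by omega), hodd, padicValNat.self (by omega)]
  ring

theorem not_two_mul_twoPart_dvd {n : ℕ} (hn : n ≠ 0) : ¬ 2 * twoPart n ∣ n := by
  rw [twoPart, ← pow_succ']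
  exact pow_succ_padicValNat_not_dvd hn

/-- Every divisor of the order of the unit group of a finite field is the order of an element. -/
theorem exists_orderOf_eq_of_dvd_card_sub_one {F : Type*} [Field F] [Fintype F] {d : ℕ}
    (hd : d ∣ Fintype.card F - 1) : ∃ x : F, orderOf x = d := by
  classical
  obtain ⟨u, hu⟩ := IsCyclic.exists_generator (α := Fˣ)
  have hcard : orderOf u = Fintype.card F - 1 := by
    rw [orderOf_eq_card_of_forall_mem_zpowers hu, Nat.card_eq_fintype_card, Fintype.card_units]
  have hpos : 0 < Fintype.card F - 1 := hcard ▸ orderOf_pos u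
  obtain ⟨k, hk⟩ := hd
  refine ⟨((u ^ k : Fˣ) : F), ?_⟩
  rw [orderOf_units, orderOf_pow, hcard, hk, Nat.gcd_mul_left_left]
  exact Nat.mul_div_cancel _ (Nat.pos_of_ne_zero (by rintro rfl; simp_all))

/-- For `q ≡ 1 (mod 4)` a prime power and `t = (q² - 1)₂`, there is `g ∈ SU(4, q)` of
order `t` intersecting the center trivially. -/
theorem su4_element_order_twoPart
    (p m q : ℕ) [Fact p.Prime] (hq : q = p ^ m) (hq4 : q % 4 = 1)
    (F : Type) [Field F] [Fintype F] [CharP F p] (hF : Fintype.card F = (p ^ m) ^ 2) :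
    ∃ g : (SU4 p m F hF), orderOf g = twoPart (q ^ 2 - 1) ∧
      Subgroup.zpowers g ⊓ Subgroup.center (SU4 p m F hF) = ⊥ := by
  set σ := iterateFrobenius F p m with hσ
  have hσq : ∀ x : F, σ x = x ^ q := fun x => by rw [hσ, iterateFrobenius_def, hq]
  have hq1 : 1 < q := by
    have := Fintype.one_lt_card (α := F)
    rw [hF, ← hq] at this
    by_contra hle
    interval_cases q <;> simp at this
  have hF' : Fintype.card F = q ^ 2 := by rw [hF, hq]
  set t := twoPart (q ^ 2 - 1) with ht
  have ht2 : t = 2 * twoPart (q - 1) := twoPart_sq_sub_one hq1 hq4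
  obtain ⟨l, hl⟩ : ∃ x : F, orderOf x = t :=
    exists_orderOf_eq_of_dvd_card_sub_one (hF' ▸ twoPart_dvd)
  obtain ⟨i, hi⟩ : ∃ i : F, i ^ 2 = -1 := by
    obtain ⟨i, hi⟩ := FiniteField.isSquare_neg_one_iff (F := F) |>.mpr (by
      rw [hF', Nat.pow_mod, hq4]; norm_num)
    exact ⟨i, by rw [pow_two, hi]⟩
  have h2 : (2 : F) ≠ 0 := by
    refine Ring.two_ne_zero fun hchar => ?_
    have hodd := FiniteField.even_card_of_char_two hchar
    rw [hF', Nat.pow_mod, show q % 2 = 1 by omega] at hodd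
    norm_num at hodd
  have hσi : σ i = i := by
    obtain ⟨k, hk⟩ : ∃ k, q = 2 * (2 * k) + 1 := ⟨q / 4, by omega⟩
    rw [hσq, hk, pow_succ, pow_mul, hi, pow_mul]
    simp
  have hl0 : l ≠ 0 := by
    rintro rfl
    have : 0 < t := by rw [ht, twoPart]; positivity
    rw [← hl, orderOf_zero] at this
    exact this.false
  have hσl : σ l = -l := by
    have hne : l ^ (q - 1) ≠ 1 := by
      rw [Ne, ← orderOf_dvd_iff_pow_eq_one, hl, ht2]
      exact not_two_mul_twoPart_dvd (by omega)
    have hsq : (l ^ (q - 1)) ^ 2 = 1 := by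
      rw [← pow_mul, ← orderOf_dvd_iff_pow_eq_one, hl, ht2, mul_comm]
      exact Nat.mul_dvd_mul_right twoPart_dvd 2
    rw [hσq, show q = q - 1 + 1 by omega, pow_succ,
      ((mul_self_eq_one_iff).mp (by rwa [← pow_two])).resolve_left hne, neg_one_mul]
  have hσl' : l * σ (-l⁻¹) = 1 := by
    rw [map_neg, map_inv₀, hσl, inv_neg, neg_neg, mul_inv_cancel₀ hl0]
  have hl' : -l⁻¹ * σ l = 1 := by
    rw [hσl, neg_mul_neg, inv_mul_cancel₀ hl0]
  have hdet : (planeRotation i l (-l⁻¹) (-1)).det = 1 := by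
    rw [det_planeRotation h2 hi]
    field_simp
  have hmem : (⟨planeRotation i l (-l⁻¹) (-1), hdet⟩ : SpecialLinearGroup (Fin 4) F) ∈
      SU4 p m F hF := by
    change ((planeRotation i l (-l⁻¹) (-1)).map σ)ᵀ * planeRotation i l (-l⁻¹) (-1) = 1
    rw [planeRotation_map_transpose hσi, planeRotation_mul h2 hi, mul_comm _ l, hσl',
      mul_comm _ (-l⁻¹), hl', map_neg, _root_.map_one, neg_mul_neg, one_mul, planeRotation_one h2]
  have hcycle : (⟨signedCycle F, det_signedCycle⟩ : SpecialLinearGroup (Fin 4) F) ∈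
      SU4 p m F hF := signedCycle_map_transpose_mul σ
  set g : SU4 p m F hF := ⟨_, hmem⟩
  have hcoe : Function.Injective fun h : SU4 p m F hF => (h.1 : Matrix (Fin 4) (Fin 4) F) :=
    Subtype.val_injective.comp Subtype.val_injective
  have hpow : ∀ n : ℕ, ((g ^ n).1 : Matrix (Fin 4) (Fin 4) F) =
      planeRotation i (l ^ n) ((-l⁻¹) ^ n) ((-1) ^ n) := fun n => by
    rw [← planeRotation_pow h2 hi]
    exact Matrix.SpecialLinearGroup.coe_pow g.1 n
  refine ⟨g, Nat.dvd_antisymm (orderOf_dvd_of_pow_eq_one (hcoe ?_)) ?_, ?_⟩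
  · have heven : Even t := ⟨_, by rw [ht2, two_mul]⟩
    have hlt : l ^ t = 1 := hl ▸ pow_orderOf_eq_one l
    change ((g ^ t).1 : Matrix (Fin 4) (Fin 4) F) = 1
    rw [hpow, heven.neg_pow, heven.neg_one_pow, inv_pow, hlt, inv_one, planeRotation_one h2]
  · rw [← hl, orderOf_dvd_iff_pow_eq_one]
    refine eq_one_of_planeRotation_eq_one h2 hi ((hpow _).symm.trans ?_)
    rw [pow_orderOf_eq_one]
    rfl
  · rw [eq_bot_iff]
    rintro h ⟨hz, hc⟩
    obtain ⟨n, rfl⟩ := mem_powers_iff_mem_zpowers.mpr hz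
    have hcomm := congrArg (fun h : SU4 p m F hF => (h.1 : Matrix (Fin 4) (Fin 4) F))
      (Subgroup.mem_center_iff.mp hc ⟨_, hcycle⟩)
    change signedCycle F * ((g ^ n).1 : Matrix (Fin 4) (Fin 4) F) =
      ((g ^ n).1 : Matrix (Fin 4) (Fin 4) F) * signedCycle F at hcomm
    rw [hpow] at hcomm
    refine Subgroup.mem_bot.mpr (hcoe ((hpow n).trans ?_))
    exact planeRotation_eq_one_of_commute hcomm.symm
end

section
/- Let q be a prime power with q ≡ 3 (mod 4), let SU(4, q) be the subgroup of SL(4, F_{q²}) consisting of all matrices g with σ(g)ᵀ g = 1, where σ is the q-th power Frobenius applied entrywise. Let r be an odd prime dividing q − 1 and set t = r·(q + 1)₂, where (q + 1)₂ is the 2-part of q + 1. Then there exists g ∈ SU(4, q) of order t such that ⟨g⟩ ∩ Z(SU(4, q)) = 1. -/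
open Matrix Polynomial

/-- The block matrix whose upper block has eigenvalues `x, x⁻¹` on the vectors `(1, e)`,
`(1, -e)`, and whose lower block is `diag(y, y⁻¹)`. -/
def blockMatrix {F : Type*} [Field F] (e : F) (x y : Fˣ) : Matrix (Fin 4) (Fin 4) F :=
  !![((x : F) + (x : F)⁻¹) / 2, e⁻¹ * ((x : F) - (x : F)⁻¹) / 2, 0, 0;
     e * ((x : F) - (x : F)⁻¹) / 2, ((x : F) + (x : F)⁻¹) / 2, 0, 0;
     0, 0, y, 0;
     0, 0, 0, (y : F)⁻¹]

theorem blockMatrix_mul {F : Type*} [Field F] (h2 : (2 : F) ≠ 0) {e : F} (he : e ≠ 0)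
    (x y x' y' : Fˣ) :
    blockMatrix e x y * blockMatrix e x' y' = blockMatrix e (x * x') (y * y') := by
  have hx := x.ne_zero
  have hx' := x'.ne_zero
  ext i j
  fin_cases i <;> fin_cases j <;>
    simp [blockMatrix, Matrix.mul_apply, Fin.sum_univ_four] <;> field_simp <;> ring

theorem det_blockMatrix {F : Type*} [Field F] (h2 : (2 : F) ≠ 0) {e : F} (he : e ≠ 0)
    (x y : Fˣ) : (blockMatrix e x y).det = 1 := by
  have hx := x.ne_zero
  have hy := y.ne_zero
  simp [blockMatrix, Matrix.det_succ_row_zero, Fin.sum_univ_succ, Fin.succAbove]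
  field_simp
  ring

theorem blockMatrix_one {F : Type*} [Field F] (h2 : (2 : F) ≠ 0) (e : F) :
    blockMatrix e 1 1 = 1 := by
  ext i j
  fin_cases i <;> fin_cases j <;> simp [blockMatrix] <;> field_simp <;> norm_num

/-- `blockMatrix` as a homomorphism from the split torus of rank two. -/
def blockHom {F : Type*} [Field F] (h2 : (2 : F) ≠ 0) {e : F} (he : e ≠ 0) :
    Fˣ × Fˣ →* SpecialLinearGroup (Fin 4) F where
  toFun z := ⟨blockMatrix e z.1 z.2, det_blockMatrix h2 he z.1 z.2⟩
  map_one' := Subtype.ext (blockMatrix_one h2 e)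
  map_mul' z w := Subtype.ext (blockMatrix_mul h2 he z.1 z.2 w.1 w.2).symm

theorem blockHom_injective {F : Type*} [Field F] (h2 : (2 : F) ≠ 0) {e : F} (he : e ≠ 0) :
    Function.Injective (blockHom h2 he) := by
  rw [injective_iff_map_eq_one]
  rintro ⟨x, y⟩ h
  have h' : blockMatrix e x y = 1 := congrArg Subtype.val h
  have h00 := congrFun (congrFun h' 0) 0
  have h10 := congrFun (congrFun h' 1) 0
  have h22 := congrFun (congrFun h' 2) 2
  simp [blockMatrix, he, h2] at h00 h10 h22
  have hx : (x : F) = 1 := by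
    rw [div_eq_iff h2, ← sub_eq_zero.mp h10] at h00
    exact mul_left_cancel₀ h2 (by linear_combination h00)
  exact Prod.ext (Units.ext hx) h22

/-- The permutation matrix of the double transposition `(0 2)(1 3)`. -/
def doubleTransposition (F : Type*) [Field F] : SpecialLinearGroup (Fin 4) F :=
  ⟨!![0, 0, 1, 0; 0, 0, 0, 1; 1, 0, 0, 0; 0, 1, 0, 0], by
    simp [Matrix.det_succ_row_zero, Fin.sum_univ_succ, Fin.succAbove]⟩

theorem sq_eq_one_and_eq_of_commute_doubleTransposition {F : Type*} [Field F]
    (h2 : (2 : F) ≠ 0) {e : F} (he : e ≠ 0) {x y : Fˣ}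
    (h : Commute (blockHom h2 he (x, y)) (doubleTransposition F)) : x ^ 2 = 1 ∧ y = x := by
  have h' : blockMatrix e x y * (doubleTransposition F).1
      = (doubleTransposition F).1 * blockMatrix e x y := congrArg Subtype.val h.eq
  have h02 := congrFun (congrFun h' 0) 2
  have h12 := congrFun (congrFun h' 1) 2
  simp [blockMatrix, doubleTransposition, Matrix.mul_apply, Fin.sum_univ_four, he, h2] at h02 h12
  have hxx := sub_eq_zero.mp h12
  refine ⟨Units.ext ?_, Units.ext ?_⟩
  · rw [Units.val_pow_eq_pow_val, pow_two]
    nth_rewrite 2 [hxx]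
    simp
  · rw [← h02, ← hxx]
    field_simp
    ring

theorem doubleTransposition_mem_SU4 (p m : ℕ) [Fact p.Prime] (F : Type*) [Field F] [Fintype F]
    [CharP F p] (hF : Fintype.card F = (p ^ m) ^ 2) : doubleTransposition F ∈ SU4 p m F hF := by
  change ((doubleTransposition F).1.map (iterateFrobenius F p m))ᵀ * (doubleTransposition F).1 = 1
  ext i j
  fin_cases i <;> fin_cases j <;>
    simp [doubleTransposition, Matrix.mul_apply, Fin.sum_univ_four]

theorem blockHom_mem_SU4 (p m : ℕ) [Fact p.Prime] {F : Type*} [Field F] [Fintype F]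
    [CharP F p] (hF : Fintype.card F = (p ^ m) ^ 2) (h2 : (2 : F) ≠ 0) {e : F} (he : e ≠ 0)
    (hee : e ^ (p ^ m + 1) = -1) {x y : Fˣ} (hx : x ^ p ^ m = x) (hy : y ^ (p ^ m + 1) = 1) :
    blockHom h2 he (x, y) ∈ SU4 p m F hF := by
  change ((blockMatrix e x y).map (iterateFrobenius F p m))ᵀ * blockMatrix e x y = 1
  set σ := iterateFrobenius F p m with hσ
  have hσx : σ (x : F) = x := by
    rw [hσ, iterateFrobenius_def, ← Units.val_pow_eq_pow_val, hx]
  have hσy : σ (y : F) = (y : F)⁻¹ := by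
    rw [hσ, iterateFrobenius_def, ← Units.val_pow_eq_pow_val, ← Units.val_inv_eq_inv_val,
      ← eq_inv_of_mul_eq_one_left ((pow_succ y _).symm.trans hy)]
  have hσe : σ e = -e⁻¹ := by
    rw [hσ, iterateFrobenius_def, ← neg_one_mul, eq_mul_inv_iff_mul_eq₀ he, ← pow_succ, hee]
  have hx0 := x.ne_zero
  have hy0 := y.ne_zero
  ext i j
  fin_cases i <;> fin_cases j <;>
    simp [blockMatrix, Matrix.mul_apply, Fin.sum_univ_four, hσx, hσy, hσe, map_ofNat σ 2] <;> field_simp <;> ring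

theorem exists_units_orderOf_eq {F : Type*} [Field F] [Fintype F] {n : ℕ}
    (hn : n ∣ Fintype.card F - 1) : ∃ x : Fˣ, orderOf x = n := by
  classical
  rw [← Fintype.card_units, ← Nat.card_eq_fintype_card] at hn
  obtain ⟨g, hg⟩ := IsCyclic.exists_ofOrder_eq_natCard (α := Fˣ)
  rw [← hg] at hn
  exact ⟨_, orderOf_pow_orderOf_div (orderOf_pos g).ne' hn⟩

/-- For `q ≡ 3 (mod 4)` a prime power, `r` an odd prime dividing `q - 1`, and
`t = r·(q + 1)₂`, there is `g ∈ SU(4, q)` of order `t` intersecting the center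
trivially. -/
theorem su4_element_order_r_twoPart
    (p m q : ℕ) [Fact p.Prime] (hq : q = p ^ m) (hq4 : q % 4 = 3)
    (F : Type) [Field F] [Fintype F] [CharP F p] (hF : Fintype.card F = (p ^ m) ^ 2)
    (r : ℕ) (hr : r.Prime) (hrodd : Odd r) (hrdvd : r ∣ q - 1) :
    ∃ g : (SU4 p m F hF), orderOf g = r * twoPart (q + 1) ∧
      Subgroup.zpowers g ⊓ Subgroup.center (SU4 p m F hF) = ⊥ := by
  have hcard : Fintype.card F - 1 = (q + 1) * (q - 1) := by
    rw [hF, ← hq, ← Nat.sq_sub_sq, one_pow]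
  have h2 : (2 : F) ≠ 0 := by
    refine Ring.two_ne_zero fun hc => ?_
    have := FiniteField.even_card_of_char_two hc
    rw [hF, ← hq, Nat.pow_mod, ← Nat.mod_mod_of_dvd q (by norm_num : 2 ∣ 4), hq4] at this
    norm_num at this
  obtain ⟨x, hx⟩ := exists_units_orderOf_eq (F := F) (hcard ▸ hrdvd.mul_left _)
  have hs : twoPart (q + 1) ∣ q + 1 := pow_padicValNat_dvd
  obtain ⟨y, hy⟩ := exists_units_orderOf_eq (F := F) (hcard ▸ hs.mul_right _)
  have h2q : 2 ∣ q - 1 := by omega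
  obtain ⟨e, he⟩ := exists_units_orderOf_eq (F := F) (hcard ▸ mul_dvd_mul_left (q + 1) h2q)
  have hee : (e : F) ^ (q + 1) = -1 := by
    have hsq : ((e : F) ^ (q + 1)) ^ 2 = 1 := by
      rw [← pow_mul, ← he, ← Units.val_pow_eq_pow_val, pow_orderOf_eq_one, Units.val_one]
    refine (sq_eq_sq_iff_eq_or_eq_neg.mp (hsq.trans (one_pow 2).symm)).resolve_left fun h => ?_
    rw [← Units.val_pow_eq_pow_val, Units.val_eq_one] at h
    have hle := orderOf_le_of_pow_eq_one (Nat.succ_pos q) h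
    omega
  have hxq : x ^ q = x := by
    have h1 : x ^ (q - 1) = 1 := orderOf_dvd_iff_pow_eq_one.mp (hx ▸ hrdvd)
    rw [← Nat.sub_add_cancel (show 1 ≤ q by omega), pow_succ, h1, one_mul]
  have hyq : y ^ (q + 1) = 1 := orderOf_dvd_iff_pow_eq_one.mp (hy ▸ hs)
  subst hq
  refine ⟨⟨_, blockHom_mem_SU4 p m hF h2 e.ne_zero hee hxq hyq⟩, ?_, ?_⟩
  · rw [Subgroup.orderOf_mk, orderOf_injective _ (blockHom_injective h2 e.ne_zero),
      Prod.orderOf_mk, hx, hy]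
    exact (hrodd.coprime_two_right.pow_right _).lcm_eq_mul
  · rw [eq_bot_iff]
    rintro _ ⟨⟨k, rfl⟩, hk⟩
    have hcomm := congrArg Subtype.val
      (Subgroup.mem_center_iff.mp hk ⟨_, doubleTransposition_mem_SU4 p m F hF⟩)
    have hpow : blockHom h2 e.ne_zero (x, y) ^ k = blockHom h2 e.ne_zero (x ^ k, y ^ k) := by
      rw [← map_zpow]; rfl
    have hcomm' : Commute (blockHom h2 e.ne_zero (x ^ k, y ^ k)) (doubleTransposition F) := by
      rw [← hpow]
      exact hcomm.symm
    obtain ⟨hsq, hyx⟩ := sq_eq_one_and_eq_of_commute_doubleTransposition h2 e.ne_zero hcomm'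
    have hxr : (x ^ k) ^ r = 1 := by
      rw [← zpow_natCast, zpow_comm, zpow_natCast, ← hx, pow_orderOf_eq_one, _root_.one_zpow]
    have hx1 : x ^ k = 1 := by
      have := pow_gcd_eq_one.mpr ⟨hxr, hsq⟩
      rwa [hrodd.coprime_two_right, pow_one] at this
    rw [Subgroup.mem_bot]
    apply Subtype.ext
    change blockHom h2 e.ne_zero (x, y) ^ k = 1
    rw [hpow, hyx, hx1]
    exact map_one _
end
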